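/- Let P be an extended logic program and E(P) the program without negation as failure in heads obtained from P by replacing each rule a ← β with head an ordinary literal a by a ← β, not ¬a, not a° (a° a fresh atom), and each rule not a ← β by a° ← β, not a. Then S is an extended answer set of P if and only if there is an answer set S' of E(P) such that S = S' ∩ (H_B(P) ∪ ¬H_B(P)). -/

import Mathlib

namespace ASP

/-- A literal is an atom `a` or a negated atom `¬ a`. -/
inductive Lit (α : Type) : Type where
  | pos (a : α)
  | neg (a : α)
deriving DecidableEq

/-- Classical negation of a literal. -/
def Lit.negate {α : Type} : Lit α → Lit α
  | .pos a => .neg a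
  | .neg a => .pos a

/-- The atom underlying a literal. -/
def Lit.atom {α : Type} : Lit α → α
  | .pos a => a
  | .neg a => a

/-- A rule of a simple logic program: a head which is a literal or absent
(a constraint), and a finite set of literals as body. -/
structure Rule (α : Type) [DecidableEq α] : Type where
  head : Option (Lit α)
  body : Finset (Lit α)

variable {α : Type} [DecidableEq α]

/-- A set of literals is consistent if it contains no complementary pair. -/
def Consistent (I : Set (Lit α)) : Prop :=
  ∀ a : α, ¬(Lit.pos a ∈ I ∧ Lit.neg a ∈ I)

/-- The Herbrand base of a program: all atoms occurring in it. -/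
def herbrand (P : Set (Rule α)) : Set α :=
  {a | ∃ r ∈ P, (∃ l, r.head = some l ∧ l.atom = a) ∨ (∃ l ∈ r.body, l.atom = a)}

/-- An interpretation of `P`: a consistent set of literals over the Herbrand base of `P`. -/
def IsInterp (P : Set (Rule α)) (I : Set (Lit α)) : Prop :=
  Consistent I ∧ ∀ l ∈ I, l.atom ∈ herbrand P

/-- A rule `a ← β` is satisfied by `I` if `a ∈ I` whenever `β ⊆ I`;
a constraint `← β` is satisfied if its body is not contained in `I`. -/
def Satisfied (I : Set (Lit α)) (r : Rule α) : Prop :=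
  ↑r.body ⊆ I → ∃ l, r.head = some l ∧ l ∈ I

/-- A rule is applied w.r.t. `I` if its body holds and its head literal is in `I`. -/
def Applied (I : Set (Lit α)) (r : Rule α) : Prop :=
  ↑r.body ⊆ I ∧ ∃ l, r.head = some l ∧ l ∈ I

/-- A rule `a ← β` is defeated w.r.t. `P` and `I` iff `P` contains an applied
competing rule `¬a ← β'`. -/
def Defeated (P : Set (Rule α)) (I : Set (Lit α)) (r : Rule α) : Prop :=
  ∃ l, r.head = some l ∧ ∃ r' ∈ P, r'.head = some l.negate ∧ Applied I r'

/-- The reduct of `P` w.r.t. `I`: the rules of `P` satisfied by `I`. -/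
def reduct (P : Set (Rule α)) (I : Set (Lit α)) : Set (Rule α) :=
  {r ∈ P | Satisfied I r}

/-- `star R` is the unique minimal model of `R` viewed as a positive program
(negative literals treated as fresh atoms; constraints never fire their head). -/
def star (R : Set (Rule α)) : Set (Lit α) :=
  ⋂₀ {J : Set (Lit α) | ∀ r ∈ R, ↑r.body ⊆ J → ∀ l, r.head = some l → l ∈ J}

/-- An interpretation is founded iff `(P_I)* = I`. -/
def Founded (P : Set (Rule α)) (I : Set (Lit α)) : Prop :=
  star (reduct P I) = I

/-- A founded interpretation `M` is an extended answer set of `P` iff every rule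
of `P` is satisfied or defeated w.r.t. `M`. -/
def ExtAnswerSet (P : Set (Rule α)) (M : Set (Lit α)) : Prop :=
  IsInterp P M ∧ Founded P M ∧ ∀ r ∈ P, Satisfied M r ∨ Defeated P M r

/-- An answer set of a program without negation as failure: a minimal
interpretation satisfying all rules of the program. -/
def IsAnswerSet (P : Set (Rule α)) (M : Set (Lit α)) : Prop :=
  IsInterp P M ∧ (∀ r ∈ P, Satisfied M r) ∧
    ∀ J, IsInterp P J → (∀ r ∈ P, Satisfied J r) → ¬J ⊂ M


/-- A rule possibly containing negation as failure in its body: head a literal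
or absent, body a finite set of literals (`bodyLit`) together with a finite set
of naf-literals `not l` for `l ∈ bodyNaf`. -/
structure NRule (α : Type) [DecidableEq α] : Type where
  head : Option (Lit α)
  bodyLit : Finset (Lit α)
  bodyNaf : Finset (Lit α)

variable {α : Type} [DecidableEq α]

/-- The Gelfond–Lifschitz reduct of a program with naf in rule bodies w.r.t.
`I`: delete each rule containing `not l` with `l ∈ I`, and remove all remaining
naf-literals from the bodies. -/
def GLreduct (Q : Set (NRule α)) (I : Set (Lit α)) : Set (Rule α) :=
  {r | ∃ q ∈ Q, (∀ l ∈ q.bodyNaf, l ∉ I) ∧ r = ⟨q.head, q.bodyLit⟩}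

/-- `I` is an answer set of a program `Q` with naf in rule bodies iff `I` is an
answer set of the Gelfond–Lifschitz reduct `Q^I`. -/
def NafAnswerSet (Q : Set (NRule α)) (I : Set (Lit α)) : Prop :=
  IsAnswerSet (GLreduct Q I) I

/-- An extended literal: an ordinary literal or a naf-literal `not l`. -/
inductive ELit (α : Type) : Type where
  | lit (l : Lit α)
  | naf (l : Lit α)
deriving DecidableEq

/-- The atom underlying an extended literal. -/
def ELit.atom {α : Type} : ELit α → α
  | .lit l => l.atom
  | .naf l => l.atom

/-- A rule of an extended logic program (ELP): head an extended literal or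
absent, body a finite set of extended literals (`bodyLit` for the ordinary
literals, `bodyNaf` for the literals under negation as failure). -/
structure ERule (α : Type) [DecidableEq α] : Type where
  head : Option (ELit α)
  bodyLit : Finset (Lit α)
  bodyNaf : Finset (Lit α)

section ELP

variable {α : Type} [DecidableEq α]

/-- Truth of an extended literal in an interpretation: `not l` holds iff
`l ∉ I`. -/
def EHolds (I : Set (Lit α)) : ELit α → Prop
  | .lit l => l ∈ I
  | .naf l => l ∉ I

/-- The body of an extended rule holds in `I`. -/
def EBodyTrue (I : Set (Lit α)) (r : ERule α) : Prop :=
  ↑r.bodyLit ⊆ I ∧ ∀ l ∈ r.bodyNaf, l ∉ I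

/-- An extended rule is satisfied by `I`. -/
def ESatisfied (I : Set (Lit α)) (r : ERule α) : Prop :=
  EBodyTrue I r → ∃ e, r.head = some e ∧ EHolds I e

/-- An extended rule is applied w.r.t. `I`. -/
def EApplied (I : Set (Lit α)) (r : ERule α) : Prop :=
  EBodyTrue I r ∧ ∃ e, r.head = some e ∧ EHolds I e

/-- Two extended-literal heads are inconsistent: `l` with `¬l`, and `l` with
`not l`. -/
def EIncons : ELit α → ELit α → Prop
  | .lit l, .lit m => m = l.negate
  | .lit l, .naf m => m = l
  | .naf l, .lit m => m = l
  | .naf _, .naf _ => False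

/-- An extended rule is defeated w.r.t. `P` and `I` iff `P` contains an applied
competing rule whose head is inconsistent with its head. -/
def EDefeated (P : Set (ERule α)) (I : Set (Lit α)) (r : ERule α) : Prop :=
  ∃ e, r.head = some e ∧
    ∃ r' ∈ P, ∃ e', r'.head = some e' ∧ EIncons e e' ∧ EApplied I r'

/-- The reduct `P_I`: the rules of the ELP `P` satisfied by `I`. -/
def ereduct (P : Set (ERule α)) (I : Set (Lit α)) : Set (ERule α) :=
  {r ∈ P | ESatisfied I r}

/-- The Herbrand base of an ELP. -/
def herbrandE (P : Set (ERule α)) : Set α :=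
  {a | ∃ r ∈ P, (∃ e, r.head = some e ∧ e.atom = a) ∨
    (∃ l ∈ r.bodyLit, l.atom = a) ∨ (∃ l ∈ r.bodyNaf, l.atom = a)}

/-- The Gelfond–Lifschitz reduct of an ELP w.r.t. `I`, applied to both heads
and bodies: keep a rule only if no body naf-literal `not l` has `l ∈ I`
(and strip the naf part of the body); a head `not a` is stripped (yielding a
constraint) provided `a ∈ I`, otherwise the rule is deleted. -/
def EGLreduct (Q : Set (ERule α)) (I : Set (Lit α)) : Set (Rule α) :=
  {r | ∃ q ∈ Q, (∀ l ∈ q.bodyNaf, l ∉ I) ∧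
    ((q.head = none ∧ r = ⟨none, q.bodyLit⟩) ∨
     (∃ l, q.head = some (ELit.lit l) ∧ r = ⟨some l, q.bodyLit⟩) ∨
     (∃ l, q.head = some (ELit.naf l) ∧ l ∈ I ∧ r = ⟨none, q.bodyLit⟩))}

/-- `I` is an extended answer set of the ELP `P` iff `I` is an answer set of
`P_I` (via the Gelfond–Lifschitz reduct) and each rule in `P \ P_I` is defeated
w.r.t. `I`. -/
def EExtAnswerSet (P : Set (ERule α)) (I : Set (Lit α)) : Prop :=
  IsAnswerSet (EGLreduct (ereduct P I) I) I ∧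
    ∀ r ∈ P \ ereduct P I, EDefeated P I r

/-- `R₁ ⊑ R₂` for sets of extended rules. -/
def ERuleSq (lt : ERule α → ERule α → Prop) (R₁ R₂ : Set (ERule α)) : Prop :=
  ∀ r₂ ∈ R₂ \ R₁, ∃ r₁ ∈ R₁ \ R₂, lt r₁ r₂

/-- For extended answer sets of an EOLP `(R, lt)`:
`M₁ ⊑ M₂` iff `R_{M₁} ≠ R_{M₂}` and `R_{M₁} ⊑ R_{M₂}`. -/
def EASSq (R : Set (ERule α)) (lt : ERule α → ERule α → Prop)
    (M₁ M₂ : Set (Lit α)) : Prop :=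
  ereduct R M₁ ≠ ereduct R M₂ ∧ ERuleSq lt (ereduct R M₁) (ereduct R M₂)

/-- `M₁ ⊏ M₂` iff `M₁ ⊑ M₂` and `M₁ ≠ M₂`. -/
def EASLt (R : Set (ERule α)) (lt : ERule α → ERule α → Prop)
    (M₁ M₂ : Set (Lit α)) : Prop :=
  EASSq R lt M₁ M₂ ∧ M₁ ≠ M₂

/-- A preferred answer set of the EOLP `(R, lt)`: a `⊑`-minimal extended answer
set of `R`. -/
def EPreferred (R : Set (ERule α)) (lt : ERule α → ERule α → Prop)
    (M : Set (Lit α)) : Prop :=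
  EExtAnswerSet R M ∧ ∀ N, EExtAnswerSet R N → ¬ EASLt R lt N M

end ELP

section Stmt14

variable {α : Type} [DecidableEq α]

/-- Map a literal along a function on atoms. -/
def Lit.map {β : Type} (f : α → β) : Lit α → Lit β
  | .pos a => .pos (f a)
  | .neg a => .neg (f a)

/-- Literals over the original atoms, inside the extended language that also
has a fresh atom `l°` (encoded as `Sum.inr l`) for each ordinary literal `l`. -/
def liftLit : Lit α → Lit (α ⊕ Lit α) := Lit.map Sum.inl

/-- `E(P)`: the ELP without naf in heads obtained from `P` by replacing each
rule `a ← β` (`a` an ordinary literal) by `a ← β, not ¬a, not a°` and each rule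
`not a ← β` by `a° ← β, not a`, where `a°` is a fresh atom.  Constraints are
kept.  The result is a program with naf only in rule bodies, over the atoms
`α ⊕ Lit α`. -/
def EofELP (P : Set (ERule α)) : Set (NRule (α ⊕ Lit α)) :=
  {q | ∃ r ∈ P,
    (r.head = none ∧
      q = ⟨none, r.bodyLit.image liftLit, r.bodyNaf.image liftLit⟩) ∨
    (∃ a, r.head = some (ELit.lit a) ∧
      q = ⟨some (liftLit a), r.bodyLit.image liftLit,
            insert (liftLit a.negate) (insert (Lit.pos (Sum.inr a))
              (r.bodyNaf.image liftLit))⟩) ∨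
    (∃ a, r.head = some (ELit.naf a) ∧
      q = ⟨some (Lit.pos (Sum.inr a)), r.bodyLit.image liftLit,
            insert (liftLit a) (r.bodyNaf.image liftLit)⟩)}

theorem liftLit_injective : Function.Injective (liftLit : Lit α → Lit (α ⊕ Lit α)) := by
  rintro (a | a) (b | b) h <;> simp_all [liftLit, Lit.map]

theorem liftLit_ne_pos_inr (l m : Lit α) : liftLit l ≠ Lit.pos (Sum.inr m) := by
  cases l <;> simp [liftLit, Lit.map]

theorem image_liftLit_subset_iff {b : Finset (Lit α)} {J : Set (Lit (α ⊕ Lit α))} :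
    (↑(b.image liftLit) : Set (Lit (α ⊕ Lit α))) ⊆ J ↔ (↑b : Set (Lit α)) ⊆ liftLit ⁻¹' J := by
  simp [Set.subset_def]

theorem Consistent.negate_notMem {I : Set (Lit α)} (hI : Consistent I) {l : Lit α}
    (hl : l ∈ I) : l.negate ∉ I := by
  intro hn
  cases l with
  | pos a => exact hI a ⟨hl, hn⟩
  | neg a => exact hI a ⟨hn, hl⟩

theorem IsInterp.mono {P : Set (Rule α)} {I J : Set (Lit α)} (hI : IsInterp P I) (hJ : J ⊆ I) :
    IsInterp P J :=
  ⟨fun a h => hI.1 a ⟨hJ h.1, hJ h.2⟩, fun l hl => hI.2 l (hJ hl)⟩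

/-- Every literal of an answer set is the head of an applied rule. -/
theorem IsAnswerSet.exists_rule {P : Set (Rule α)} {M : Set (Lit α)} (hM : IsAnswerSet P M)
    {l : Lit α} (hl : l ∈ M) : ∃ r ∈ P, r.head = some l ∧ (↑r.body : Set (Lit α)) ⊆ M := by
  by_contra! h
  refine hM.2.2 (M \ {l}) (hM.1.mono Set.sdiff_subset) (fun r hr hb => ?_)
    ⟨Set.sdiff_subset, fun hs => (hs hl).2 rfl⟩
  have hbM := hb.trans Set.sdiff_subset
  obtain ⟨m, hm, hmM⟩ := hM.2.1 r hr hbM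
  refine ⟨m, hm, hmM, ?_⟩
  rintro rfl
  exact h r hr hm hbM

theorem mem_GLreduct_EofELP {P : Set (ERule α)} {I : Set (Lit (α ⊕ Lit α))}
    {s : Rule (α ⊕ Lit α)} :
    s ∈ GLreduct (EofELP P) I ↔
      ∃ r ∈ P, (∀ l ∈ r.bodyNaf, l ∉ liftLit ⁻¹' I) ∧
        ((r.head = none ∧ s = ⟨none, r.bodyLit.image liftLit⟩) ∨
         (∃ a, r.head = some (ELit.lit a) ∧ a.negate ∉ liftLit ⁻¹' I ∧
            Lit.pos (Sum.inr a) ∉ I ∧ s = ⟨some (liftLit a), r.bodyLit.image liftLit⟩) ∨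
         (∃ a, r.head = some (ELit.naf a) ∧ a ∉ liftLit ⁻¹' I ∧
            s = ⟨some (Lit.pos (Sum.inr a)), r.bodyLit.image liftLit⟩)) := by
  constructor
  · rintro ⟨q, ⟨r, hr, ⟨hh, rfl⟩ | ⟨a, hh, rfl⟩ | ⟨a, hh, rfl⟩⟩, hn, rfl⟩
    · exact ⟨r, hr, by simpa using hn, .inl ⟨hh, rfl⟩⟩
    · simp only [Finset.forall_mem_insert, Finset.forall_mem_image] at hn
      exact ⟨r, hr, hn.2.2, .inr (.inl ⟨a, hh, hn.1, hn.2.1, rfl⟩)⟩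
    · simp only [Finset.forall_mem_insert, Finset.forall_mem_image] at hn
      exact ⟨r, hr, hn.2, .inr (.inr ⟨a, hh, hn.1, rfl⟩)⟩
  · rintro ⟨r, hr, hn, ⟨hh, rfl⟩ | ⟨a, hh, h₁, h₂, rfl⟩ | ⟨a, hh, h₁, rfl⟩⟩
    · exact ⟨_, ⟨r, hr, .inl ⟨hh, rfl⟩⟩, by simpa using hn, rfl⟩
    · refine ⟨_, ⟨r, hr, .inr (.inl ⟨a, hh, rfl⟩)⟩, ?_, rfl⟩
      simp only [Finset.forall_mem_insert, Finset.forall_mem_image]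
      exact ⟨h₁, h₂, hn⟩
    · refine ⟨_, ⟨r, hr, .inr (.inr ⟨a, hh, rfl⟩)⟩, ?_, rfl⟩
      simp only [Finset.forall_mem_insert, Finset.forall_mem_image]
      exact ⟨h₁, hn⟩

/-- Every literal of an extended answer set is the head of an applied rule. -/
theorem EExtAnswerSet.exists_rule {P : Set (ERule α)} {S : Set (Lit α)} (hS : EExtAnswerSet P S)
    {l : Lit α} (hl : l ∈ S) : ∃ r ∈ P, r.head = some (ELit.lit l) ∧ EBodyTrue S r := by
  obtain ⟨s, ⟨r, hr, hn, h⟩, hs, hb⟩ := hS.1.exists_rule hl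
  rcases h with ⟨-, rfl⟩ | ⟨a, hh, rfl⟩ | ⟨a, -, -, rfl⟩
  · simp at hs
  · obtain rfl : a = l := by simpa using hs
    exact ⟨r, hr.1, hh, hb, hn⟩
  · simp at hs

/-- Every original literal of an answer set of `E(P)` is the head of an applied rule of `P`. -/
theorem NafAnswerSet.exists_rule_lit {P : Set (ERule α)} {I : Set (Lit (α ⊕ Lit α))}
    (hI : NafAnswerSet (EofELP P) I) {l : Lit α} (hl : l ∈ liftLit ⁻¹' I) :
    ∃ r ∈ P, r.head = some (ELit.lit l) ∧ EBodyTrue (liftLit ⁻¹' I) r := by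
  obtain ⟨s, hs, hh, hb⟩ := IsAnswerSet.exists_rule hI hl
  obtain ⟨r, hr, hn, ⟨-, rfl⟩ | ⟨a, ha, -, -, rfl⟩ | ⟨a, -, -, rfl⟩⟩ := mem_GLreduct_EofELP.1 hs
  · simp at hh
  · obtain rfl : a = l := liftLit_injective (by simpa using hh)
    exact ⟨r, hr, ha, image_liftLit_subset_iff.1 hb, hn⟩
  · exact absurd (Option.some.inj hh).symm (liftLit_ne_pos_inr l a)

/-- If `a°` is in an answer set of `E(P)`, then some rule `not a ← β` of `P` is applied. -/
theorem NafAnswerSet.exists_rule_naf {P : Set (ERule α)} {I : Set (Lit (α ⊕ Lit α))}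
    (hI : NafAnswerSet (EofELP P) I) {l : Lit α} (hl : Lit.pos (Sum.inr l) ∈ I) :
    ∃ r ∈ P, r.head = some (ELit.naf l) ∧ EBodyTrue (liftLit ⁻¹' I) r ∧ l ∉ liftLit ⁻¹' I := by
  obtain ⟨s, hs, hh, hb⟩ := IsAnswerSet.exists_rule hI hl
  obtain ⟨r, hr, hn, ⟨-, rfl⟩ | ⟨a, -, -, -, rfl⟩ | ⟨a, ha, hna, rfl⟩⟩ :=
    mem_GLreduct_EofELP.1 hs
  · simp at hh
  · exact absurd (Option.some.inj hh) (liftLit_ne_pos_inr a l)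
  · obtain rfl : a = l := by simpa using hh
    exact ⟨r, hr, ha, ⟨image_liftLit_subset_iff.1 hb, hn⟩, hna⟩

/-- The interpretation of `E(P)` extending `S` by the atoms `a°` for which some rule
`not a ← β` is applied w.r.t. `S`. -/
def extendNaf (P : Set (ERule α)) (S : Set (Lit α)) : Set (Lit (α ⊕ Lit α)) :=
  liftLit '' S ∪
    {x | ∃ a, x = Lit.pos (Sum.inr a) ∧ a ∉ S ∧
      ∃ r ∈ P, r.head = some (ELit.naf a) ∧ EBodyTrue S r}

theorem preimage_extendNaf (P : Set (ERule α)) (S : Set (Lit α)) :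
    liftLit ⁻¹' extendNaf P S = S := by
  ext l
  constructor
  · rintro (⟨m, hm, h⟩ | ⟨a, h, -⟩)
    · exact liftLit_injective h ▸ hm
    · exact absurd h (liftLit_ne_pos_inr l a)
  · exact fun h => .inl ⟨l, h, rfl⟩

theorem pos_inr_mem_extendNaf {P : Set (ERule α)} {S : Set (Lit α)} {a : Lit α} :
    Lit.pos (Sum.inr a) ∈ extendNaf P S ↔
      a ∉ S ∧ ∃ r ∈ P, r.head = some (ELit.naf a) ∧ EBodyTrue S r := by
  constructor
  · rintro (⟨m, -, h⟩ | ⟨b, h, hb⟩)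
    · exact absurd h (liftLit_ne_pos_inr m a)
    · obtain rfl : a = b := by simpa using h
      exact hb
  · exact fun h => .inr ⟨a, rfl, h⟩

theorem Consistent.extendNaf {P : Set (ERule α)} {S : Set (Lit α)} (hS : Consistent S) :
    Consistent (extendNaf P S) := by
  rintro (a | a) ⟨hp, hn⟩
  · refine hS a ⟨?_, ?_⟩
    · rw [← preimage_extendNaf P S]; exact hp
    · rw [← preimage_extendNaf P S]; exact hn
  · rcases hn with ⟨m, -, h⟩ | ⟨b, h, -⟩
    · cases m <;> simp [liftLit, Lit.map] at h
    · simp at h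

theorem EExtAnswerSet.nafAnswerSet_extendNaf {P : Set (ERule α)} {S : Set (Lit α)}
    (hS : EExtAnswerSet P S) : NafAnswerSet (EofELP P) (extendNaf P S) := by
  have hcons := hS.1.1.1
  have hlit : ∀ r ∈ P, ∀ a, r.head = some (ELit.lit a) → a ∈ S → EBodyTrue S r →
      (⟨some (liftLit a), r.bodyLit.image liftLit⟩ : Rule (α ⊕ Lit α)) ∈
        GLreduct (EofELP P) (extendNaf P S) := by
    intro r hr a hh ha hb
    rw [mem_GLreduct_EofELP, preimage_extendNaf]
    exact ⟨r, hr, hb.2, .inr (.inl ⟨a, hh, hcons.negate_notMem ha,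
      fun h => (pos_inr_mem_extendNaf.1 h).1 ha, rfl⟩)⟩
  have hnaf : ∀ r ∈ P, ∀ a, r.head = some (ELit.naf a) → a ∉ S → EBodyTrue S r →
      (⟨some (Lit.pos (Sum.inr a)), r.bodyLit.image liftLit⟩ : Rule (α ⊕ Lit α)) ∈
        GLreduct (EofELP P) (extendNaf P S) := by
    intro r hr a hh ha hb
    rw [mem_GLreduct_EofELP, preimage_extendNaf]
    exact ⟨r, hr, hb.2, .inr (.inr ⟨a, hh, ha, rfl⟩)⟩
  refine ⟨⟨hcons.extendNaf, ?_⟩, ?_, ?_⟩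
  · rintro _ (⟨l, hl, rfl⟩ | ⟨a, rfl, ha, r, hr, hh, hb⟩)
    · obtain ⟨r, hr, hh, hb⟩ := hS.exists_rule hl
      exact ⟨_, hlit r hr l hh hl hb, .inl ⟨_, rfl, rfl⟩⟩
    · exact ⟨_, hnaf r hr a hh ha hb, .inl ⟨_, rfl, rfl⟩⟩
  · intro s hs hsb
    rw [mem_GLreduct_EofELP, preimage_extendNaf] at hs
    obtain ⟨r, hr, hn, ⟨hh, rfl⟩ | ⟨a, hh, h₁, h₂, rfl⟩ | ⟨a, hh, h₁, rfl⟩⟩ := hs <;>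
      rw [image_liftLit_subset_iff, preimage_extendNaf] at hsb <;>
      have hb : EBodyTrue S r := ⟨hsb, hn⟩
    · by_cases hsat : ESatisfied S r
      · obtain ⟨e, he, -⟩ := hsat hb
        simp [hh] at he
      · obtain ⟨e, he, -⟩ := hS.2 r ⟨hr, fun h => hsat h.2⟩
        simp [hh] at he
    · refine ⟨_, rfl, .inl ⟨a, ?_, rfl⟩⟩
      by_contra ha
      have hsat : ¬ ESatisfied S r := by
        intro h
        obtain ⟨e, he, h'⟩ := h hb
        obtain rfl : ELit.lit a = e := by simpa [hh] using he
        exact ha h'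
      obtain ⟨e, he, r', hr', e', he', hinc, hb', f, hf, hf'⟩ := hS.2 r ⟨hr, fun h => hsat h.2⟩
      obtain rfl : ELit.lit a = e := by simpa [hh] using he
      obtain rfl : e' = f := by simpa [he'] using hf
      cases e' with
      | lit m => obtain rfl : m = a.negate := hinc; exact h₁ hf'
      | naf m =>
        obtain rfl : m = a := hinc
        exact h₂ (pos_inr_mem_extendNaf.2 ⟨ha, r', hr', he', hb'⟩)
    · exact ⟨_, rfl, pos_inr_mem_extendNaf.2 ⟨h₁, r, hr, hh, hb⟩⟩
  · rintro J - hJ ⟨hJS, hne⟩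
    have hsub : liftLit ⁻¹' J ⊆ S := by
      rw [← preimage_extendNaf P S]; exact Set.preimage_mono hJS
    have hSJ : S ⊆ liftLit ⁻¹' J := by
      by_contra hSJ
      refine hS.1.2.2 _ (hS.1.1.mono hsub) ?_ ⟨hsub, hSJ⟩
      rintro s hs hsb
      obtain ⟨m, hm, hmS⟩ := hS.1.2.1 s hs (hsb.trans hsub)
      refine ⟨m, hm, ?_⟩
      obtain ⟨r, hr, hn, ⟨-, rfl⟩ | ⟨a, hh, rfl⟩ | ⟨a, -, -, rfl⟩⟩ := hs
      · simp at hm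
      · obtain rfl : a = m := by simpa using hm
        obtain ⟨k, hk, hkJ⟩ := hJ _ (hlit r hr.1 a hh hmS ⟨hsb.trans hsub, hn⟩)
          (image_liftLit_subset_iff.2 hsb)
        obtain rfl : liftLit a = k := by simpa using hk
        exact hkJ
      · simp at hm
    refine hne ?_
    rintro _ (⟨l, hl, rfl⟩ | ⟨a, rfl, ha, r, hr, hh, hb⟩)
    · exact hSJ hl
    · obtain ⟨k, hk, hkJ⟩ := hJ _ (hnaf r hr a hh ha hb)
        (image_liftLit_subset_iff.2 (hb.1.trans hSJ))
      obtain rfl : Lit.pos (Sum.inr a) = k := by simpa using hk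
      exact hkJ

theorem NafAnswerSet.eExtAnswerSet_preimage {P : Set (ERule α)} {I : Set (Lit (α ⊕ Lit α))}
    (hI : NafAnswerSet (EofELP P) I) : EExtAnswerSet P (liftLit ⁻¹' I) := by
  have hsat : ∀ s ∈ GLreduct (EofELP P) I, Satisfied I s := hI.2.1
  refine ⟨⟨⟨fun a h => hI.1.1 (Sum.inl a) h, ?_⟩, ?_, ?_⟩, ?_⟩
  · intro l hl
    obtain ⟨r, hr, hh, hb⟩ := hI.exists_rule_lit hl
    exact ⟨⟨some l, r.bodyLit⟩, ⟨r, ⟨hr, fun _ => ⟨_, hh, hl⟩⟩, hb.2,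
      .inr (.inl ⟨l, hh, rfl⟩)⟩, .inl ⟨l, rfl, rfl⟩⟩
  · rintro s ⟨r, hr, hn, h⟩ hsb
    rcases h with ⟨hh, rfl⟩ | ⟨a, hh, rfl⟩ | ⟨a, hh, ha, rfl⟩ <;>
      obtain ⟨e, he, he'⟩ := hr.2 ⟨hsb, hn⟩
    · simp [hh] at he
    · obtain rfl : ELit.lit a = e := by simpa [hh] using he
      exact ⟨a, rfl, he'⟩
    · obtain rfl : ELit.naf a = e := by simpa [hh] using he
      exact absurd ha he'
  · rintro J - hJ ⟨hJI, hne⟩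
    have hpre : liftLit ⁻¹' {x ∈ I | ∀ l, x = liftLit l → l ∈ J} ⊆ J :=
      fun l hl => hl.2 l rfl
    refine hI.2.2 {x ∈ I | ∀ l, x = liftLit l → l ∈ J}
      (IsInterp.mono hI.1 (Set.sep_subset _ _)) ?_
      ⟨Set.sep_subset _ _, fun h => hne fun l hl => (h hl).2 l rfl⟩
    intro s hs hsb
    obtain ⟨k, hk, hkI⟩ := hsat s hs (hsb.trans (Set.sep_subset _ _))
    refine ⟨k, hk, hkI, ?_⟩
    rintro l rfl
    obtain ⟨r, hr, hn, ⟨-, rfl⟩ | ⟨a, hh, -, -, rfl⟩ | ⟨a, -, -, rfl⟩⟩ :=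
      mem_GLreduct_EofELP.1 hs
    · simp at hk
    · obtain rfl : a = l := liftLit_injective (by simpa using hk)
      obtain ⟨m, hm, hmJ⟩ := hJ ⟨some a, r.bodyLit⟩
        ⟨r, ⟨hr, fun _ => ⟨_, hh, hkI⟩⟩, hn, .inr (.inl ⟨a, hh, rfl⟩)⟩
        ((image_liftLit_subset_iff.1 hsb).trans hpre)
      obtain rfl : a = m := by simpa using hm
      exact hmJ
    · exact absurd (Option.some.inj hk).symm (liftLit_ne_pos_inr l a)
  · rintro r ⟨hr, hns⟩
    have hns : ¬ ESatisfied (liftLit ⁻¹' I) r := fun h => hns ⟨hr, h⟩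
    obtain ⟨hb, hne⟩ := Classical.not_imp.1 hns
    have hsb := image_liftLit_subset_iff.2 hb.1
    match hh : r.head with
    | none =>
      obtain ⟨k, hk, -⟩ := hsat _ (mem_GLreduct_EofELP.2 ⟨r, hr, hb.2, .inl ⟨hh, rfl⟩⟩) hsb
      simp at hk
    | some (.lit a) =>
      refine ⟨_, hh, ?_⟩
      by_cases h₁ : a.negate ∈ liftLit ⁻¹' I
      · obtain ⟨r', hr', hh', hb'⟩ := hI.exists_rule_lit h₁
        exact ⟨r', hr', _, hh', rfl, hb', _, hh', h₁⟩
      by_cases h₂ : Lit.pos (Sum.inr a) ∈ I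
      · obtain ⟨r', hr', hh', hb', ha⟩ := hI.exists_rule_naf h₂
        exact ⟨r', hr', _, hh', rfl, hb', _, hh', ha⟩
      obtain ⟨k, hk, hkI⟩ := hsat _
        (mem_GLreduct_EofELP.2 ⟨r, hr, hb.2, .inr (.inl ⟨a, hh, h₁, h₂, rfl⟩)⟩) hsb
      obtain rfl : liftLit a = k := by simpa using hk
      exact absurd ⟨_, hh, hkI⟩ hne
    | some (.naf a) =>
      have ha : a ∈ liftLit ⁻¹' I := by
        by_contra ha
        exact hne ⟨_, hh, ha⟩
      obtain ⟨r', hr', hh', hb'⟩ := hI.exists_rule_lit ha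
      exact ⟨_, hh, r', hr', _, hh', rfl, hb', _, hh', ha⟩

/-- `S` is an extended answer set of the ELP `P` iff there is an
answer set `S'` of `E(P)` such that `S = S' ∩ (H_B(P) ∪ ¬H_B(P))`. -/
theorem eExtAnswerSet_iff_answerSet_EofELP
    (P : Set (ERule α)) (hP : P.Countable) (S : Set (Lit α)) :
    EExtAnswerSet P S ↔
      ∃ S' : Set (Lit (α ⊕ Lit α)), NafAnswerSet (EofELP P) S' ∧
        S = {l : Lit α | l.atom ∈ herbrandE P ∧ liftLit l ∈ S'} := by
  constructor
  · intro hS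
    refine ⟨extendNaf P S, hS.nafAnswerSet_extendNaf, Set.ext fun l => ⟨fun hl => ?_, fun hl => ?_⟩⟩
    · obtain ⟨r, hr, hh, -⟩ := hS.exists_rule hl
      exact ⟨⟨r, hr, .inl ⟨_, hh, rfl⟩⟩, .inl ⟨l, hl, rfl⟩⟩
    · rw [← preimage_extendNaf P S]
      exact hl.2
  · rintro ⟨I, hI, rfl⟩
    convert hI.eExtAnswerSet_preimage using 1
    refine Set.ext fun l => ⟨fun hl => hl.2, fun hl => ⟨?_, hl⟩⟩
    obtain ⟨r, hr, hh, -⟩ := hI.exists_rule_lit hl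
    exact ⟨r, hr, .inl ⟨_, hh, rfl⟩⟩

end Stmt14

end ASP
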